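/- arXiv:2210.05222 — 10 statements merged into one kernel-verified Lean document; each statement's English description precedes it below -/
import Mathlib

section
/- Regret bound for deterministic direct search (Theorem 1 / Theorem A.1). Under the direct-search dynamics driven by the positive spanning set D, for every K ∈ ℕ the quantity R̃_K := ∑_{k=0}^{K} [ (f(x_k) − f(x*)) + ∑_{v ∈ D} (f(x_k + α_k • v) − f(x*)) ] satisfies R̃_K ≤ (|D| + 1) · [ ((f(x_0) − f(x*)) / (c α₀²)) · ( f(x_0) − f(x*) + (β/a)‖∇f(x_0)‖ α₀ + β α₀² ) + (1/(c(1 − θ²))) (f(x_0) − f(x*) + c α₀²) · ( (1 + η/a) η + β ) ], where η := (β/(aκθ))(c + β/2). -/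
open RealInnerProductSpace Finset

section FirstOrder

variable {E : Type*} [NormedAddCommGroup E] [InnerProductSpace ℝ E] {f : E → ℝ} {g : E → E}
  {a β : ℝ}

/-- A convex function with `β`-Lipschitz gradient `g` has a quadratic upper model. -/
theorem le_quadratic_model (ha : 0 < a)
    (hsmooth : ∀ x y, ‖g x - g y‖ ≤ β * ‖x - y‖)
    (hconv : ∀ x y, f y ≥ f x + inner ℝ (g x) (y - x) + a * ‖y - x‖ ^ 2) (x y : E) :
    f y ≤ f x + inner ℝ (g x) (y - x) + β * ‖y - x‖ ^ 2 := by
  have h1 := hconv y x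
  have h2 : inner ℝ (g y - g x) (y - x) ≤ β * ‖y - x‖ * ‖y - x‖ :=
    (real_inner_le_norm _ _).trans
      (mul_le_mul_of_nonneg_right (hsmooth y x) (norm_nonneg _))
  rw [inner_sub_left] at h2
  have h3 : inner ℝ (g y) (x - y) = - inner ℝ (g y) (y - x) := by
    rw [← inner_neg_right, neg_sub]
  have h4 : 0 ≤ a * ‖x - y‖ ^ 2 := by positivity
  nlinarith

/-- The strong convexity modulus is at most half the smoothness constant. -/
theorem two_mul_modulus_le [Nontrivial E]
    (hsmooth : ∀ x y, ‖g x - g y‖ ≤ β * ‖x - y‖)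
    (hconv : ∀ x y, f y ≥ f x + inner ℝ (g x) (y - x) + a * ‖y - x‖ ^ 2) :
    2 * a ≤ β := by
  obtain ⟨e, he⟩ := exists_norm_eq E (zero_le_one (α := ℝ))
  have h1 := hconv 0 e
  have h2 := hconv e 0
  have h3 : inner ℝ (g e - g 0) e ≤ β * ‖e - 0‖ * ‖e‖ :=
    (real_inner_le_norm _ _).trans
      (mul_le_mul_of_nonneg_right (hsmooth e 0) (norm_nonneg _))
  rw [inner_sub_left] at h3
  simp only [sub_zero, zero_sub, norm_neg, inner_neg_right, he] at h1 h2 h3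
  linarith

/-- Polyak–Łojasiewicz inequality for strongly convex functions. -/
theorem four_mul_modulus_mul_gap_le (ha : 0 < a)
    (hconv : ∀ x y, f y ≥ f x + inner ℝ (g x) (y - x) + a * ‖y - x‖ ^ 2) (x y : E) :
    4 * a * (f x - f y) ≤ ‖g x‖ ^ 2 := by
  have h1 := hconv x y
  have h2 := neg_le_of_abs_le (abs_real_inner_le_norm (g x) (y - x))
  have h3 : f x - f y ≤ ‖g x‖ * ‖y - x‖ - a * ‖y - x‖ ^ 2 := by linarith
  nlinarith [sq_nonneg (‖g x‖ - 2 * a * ‖y - x‖)]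

/-- The gradient is controlled by the optimality gap. -/
theorem modulus_mul_norm_sq_le (ha : 0 ≤ a) (hβ : 0 < β)
    (hsmooth : ∀ x y, ‖g x - g y‖ ≤ β * ‖x - y‖)
    (hconv : ∀ x y, f y ≥ f x + inner ℝ (g x) (y - x) + a * ‖y - x‖ ^ 2) {z : E} (hz : g z = 0)
    (x : E) : a * ‖g x‖ ^ 2 ≤ β ^ 2 * (f x - f z) := by
  have h1 := hconv z x
  have h2 := hsmooth x z
  rw [hz, sub_zero] at h2
  rw [hz, inner_zero_left] at h1
  have h3 : ‖g x‖ ^ 2 ≤ (β * ‖x - z‖) ^ 2 := by gcongr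
  calc a * ‖g x‖ ^ 2 ≤ a * (β * ‖x - z‖) ^ 2 := by gcongr
    _ = β ^ 2 * (a * ‖x - z‖ ^ 2) := by ring
    _ ≤ β ^ 2 * (f x - f z) := by gcongr; linarith

/-- If no polling direction gives sufficient decrease, then the gradient is of the order of the
step size. -/
theorem norm_gradient_le_of_no_decrease (ha : 0 < a)
    (hsmooth : ∀ x y, ‖g x - g y‖ ≤ β * ‖x - y‖)
    (hconv : ∀ x y, f y ≥ f x + inner ℝ (g x) (y - x) + a * ‖y - x‖ ^ 2)
    {D : Finset E} (hunit : ∀ v ∈ D, ‖v‖ = 1) {κ c s : ℝ}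
    (hcm : ∀ u : E, u ≠ 0 → ∃ v ∈ D, inner ℝ u v ≥ κ * ‖u‖) (hs : 0 < s) (hcβ : 0 ≤ c + β)
    {x : E} (hx : ∀ v ∈ D, f x - f (x + s • v) < c * s ^ 2) :
    κ * ‖g x‖ ≤ (c + β) * s := by
  by_cases h0 : g x = 0
  · rw [h0, norm_zero, mul_zero]; positivity
  obtain ⟨v, hv, hκv⟩ := hcm (-g x) (neg_ne_zero.2 h0)
  have h1 := hx v hv
  have h2 := le_quadratic_model ha hsmooth hconv x (x + s • v)
  rw [add_sub_cancel_left, norm_smul, hunit v hv, Real.norm_eq_abs, mul_one, sq_abs,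
    real_inner_smul_right] at h2
  rw [norm_neg, inner_neg_left] at hκv
  have h3 : s * (κ * ‖g x‖) ≤ s * -inner ℝ (g x) v := by gcongr
  exact le_of_mul_le_mul_left (by nlinarith) hs

/-- Regret of one polling round in terms of the gradient and the step size. -/
theorem polling_regret_le (ha : 0 < a)
    (hsmooth : ∀ x y, ‖g x - g y‖ ≤ β * ‖x - y‖) (hβ : 0 < β)
    (hconv : ∀ x y, f y ≥ f x + inner ℝ (g x) (y - x) + a * ‖y - x‖ ^ 2)
    {D : Finset E} (hunit : ∀ v ∈ D, ‖v‖ = 1) {s : ℝ} (hs : 0 < s) (x z : E) :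
    (f x - f z) + ∑ v ∈ D, (f (x + s • v) - f z) ≤
      ((D.card : ℝ) + 1) * (f x - f z + ‖g x‖ * s + β * s ^ 2) := by
  have h : ∀ v ∈ D, f (x + s • v) - f z ≤ f x - f z + ‖g x‖ * s + β * s ^ 2 := by
    intro v hv
    have h2 := le_quadratic_model ha hsmooth hconv x (x + s • v)
    have h3 := real_inner_le_norm (g x) (s • v)
    rw [add_sub_cancel_left] at h2
    rw [norm_smul, hunit v hv, Real.norm_eq_abs, mul_one, abs_of_pos hs] at h2 h3
    linarith
  have h1 := Finset.sum_le_card_nsmul D _ _ h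
  rw [nsmul_eq_mul] at h1
  have h4 : 0 ≤ ‖g x‖ * s + β * s ^ 2 := by positivity
  linarith

end FirstOrder

/-- The step sizes stay positive. -/
theorem stepSize_pos {α : ℕ → ℝ} {S : Set ℕ} {θ : ℝ} (hθ : 0 < θ) (h0 : 0 < α 0)
    (hS : ∀ k ∈ S, α (k + 1) = α k) (hF : ∀ k ∉ S, α (k + 1) = θ * α k) (k : ℕ) : 0 < α k := by
  induction k with
  | zero => exact h0
  | succ k ih =>
    by_cases hk : k ∈ S
    · rwa [hS k hk]
    · rw [hF k hk]; positivity

theorem stmt0 {d : ℕ} (hd : 1 ≤ d)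
    (f : EuclideanSpace ℝ (Fin d) → ℝ) (a β : ℝ) (ha : 0 < a) (hβ : 0 < β)
    (hdiff : ContDiff ℝ 1 f)
    (hsmooth : ∀ x y : EuclideanSpace ℝ (Fin d), ‖gradient f x - gradient f y‖ ≤ β * ‖x - y‖)
    (hconv : ∀ x y : EuclideanSpace ℝ (Fin d),
      f y ≥ f x + ⟪gradient f x, y - x⟫ + a * ‖y - x‖ ^ 2)
    (xstar : EuclideanSpace ℝ (Fin d)) (hmin : ∀ y, f xstar ≤ f y)
    (D : Finset (EuclideanSpace ℝ (Fin d))) (hDne : D.Nonempty)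
    (hunit : ∀ v ∈ D, ‖v‖ = 1) (κ : ℝ) (hκ : 0 < κ)
    (hcm : ∀ u : EuclideanSpace ℝ (Fin d), u ≠ 0 → ∃ v ∈ D, ⟪u, v⟫ ≥ κ * ‖u‖)
    (α₀ θ c : ℝ) (hα₀ : 0 < α₀) (hθ : θ ∈ Set.Ioo (0 : ℝ) 1) (hc : 0 < c)
    (x : ℕ → EuclideanSpace ℝ (Fin d)) (α : ℕ → ℝ) (S : Set ℕ) (hα0 : α 0 = α₀)
    (hsucc : ∀ k ∈ S, ∃ v ∈ D, f (x k) - f (x k + α k • v) ≥ c * α k ^ 2 ∧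
      x (k + 1) = x k + α k • v ∧ α (k + 1) = α k)
    (hfail : ∀ k ∉ S, (∀ v ∈ D, f (x k) - f (x k + α k • v) < c * α k ^ 2) ∧
      x (k + 1) = x k ∧ α (k + 1) = θ * α k)
    (K : ℕ) :
    ∑ k ∈ Finset.range (K + 1),
        ((f (x k) - f xstar) + ∑ v ∈ D, (f (x k + α k • v) - f xstar)) ≤
      ((D.card : ℝ) + 1) *
        (((f (x 0) - f xstar) / (c * α₀ ^ 2)) *
            (f (x 0) - f xstar + (β / a) * ‖gradient f (x 0)‖ * α₀ + β * α₀ ^ 2) +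
          (1 / (c * (1 - θ ^ 2))) * (f (x 0) - f xstar + c * α₀ ^ 2) *
            ((1 + (β / (a * κ * θ)) * (c + β / 2) / a) * ((β / (a * κ * θ)) * (c + β / 2)) + β)) := by
  obtain ⟨hθ0, hθ1⟩ := hθ
  have : Nonempty (Fin d) := ⟨⟨0, hd⟩⟩
  have hβa := two_mul_modulus_le hsmooth hconv
  have hz : gradient f xstar = 0 := by
    have hloc : IsLocalMin f xstar := Filter.Eventually.of_forall hmin
    rw [gradient, hloc.fderiv_eq_zero, map_zero]
  have hpos : ∀ k, 0 < α k := stepSize_pos hθ0 (hα0 ▸ hα₀)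
    (fun k hk => by obtain ⟨v, -, -, -, h⟩ := hsucc k hk; exact h) (fun k hk => (hfail k hk).2.2)
  have hθ2 : 0 < 1 - θ ^ 2 := by nlinarith
  obtain ⟨A, hA⟩ : ∃ A, A = (c + β / 2) / κ := ⟨_, rfl⟩
  have hA0 : 0 < A := by rw [hA]; positivity
  obtain ⟨η, hη⟩ : ∃ η, η = β / (a * κ * θ) * (c + β / 2) := ⟨_, rfl⟩
  have hηA : a * θ * η = β * A := by rw [hη, hA]; field_simp
  have hη0 : 0 < η := by rw [hη]; positivity
  have hAη : 2 * A ≤ η := by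
    have h1 : a * (2 * A) ≤ a * η := by nlinarith [mul_pos ha hη0]
    exact le_of_mul_le_mul_left h1 ha
  obtain ⟨Δ, hΔ⟩ : ∃ Δ : ℕ → ℝ, Δ = fun k => f (x k) - f xstar := ⟨_, rfl⟩
  have hΔk : ∀ k, Δ k = f (x k) - f xstar := fun k => by rw [hΔ]
  have hΔ0 : ∀ k, 0 ≤ Δ k := fun k => by rw [hΔk]; linarith [hmin (x k)]
  have hstepS : ∀ k ∈ S, α (k + 1) = α k ∧ c * α k ^ 2 ≤ Δ k - Δ (k + 1) := by
    intro k hk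
    obtain ⟨v, -, h1, h2, h3⟩ := hsucc k hk
    refine ⟨h3, ?_⟩
    rw [hΔk, hΔk, h2]; linarith
  have hstepF : ∀ k ∉ S, α (k + 1) = θ * α k ∧ Δ (k + 1) = Δ k ∧
      ‖gradient f (x k)‖ ≤ 2 * A * α k := by
    intro k hk
    obtain ⟨h1, h2, h3⟩ := hfail k hk
    refine ⟨h3, by rw [hΔk, hΔk, h2], ?_⟩
    have h4 := norm_gradient_le_of_no_decrease ha hsmooth hconv hunit hcm (hpos k)
      (by positivity) h1
    have h5 : κ * (2 * A * α k) = (2 * c + β) * α k := by rw [hA]; field_simp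
    refine le_of_mul_le_mul_left ?_ hκ
    nlinarith [mul_pos hc (hpos k)]
  have hPL : ∀ k, 4 * a * Δ k ≤ ‖gradient f (x k)‖ ^ 2 := fun k => by
    rw [hΔk]; exact four_mul_modulus_mul_gap_le ha hconv _ _
  have hgrad : ∀ k, a * ‖gradient f (x k)‖ ^ 2 ≤ β ^ 2 * Δ k := fun k => by
    rw [hΔk]; exact modulus_mul_norm_sq_le ha.le hβ hsmooth hconv hz _
  have hanti : ∀ k, Δ (k + 1) ≤ Δ k := by
    intro k
    by_cases hk : k ∈ S
    · linarith [(hstepS k hk).2, mul_pos hc (pow_pos (hpos k) 2)]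
    · exact (hstepF k hk).2.1.le
  have hanti0 : ∀ k, Δ k ≤ Δ 0 := fun k => antitone_nat_of_succ_le hanti (Nat.zero_le k)
  have hinv : ∀ k, α k = α₀ ∨ a * θ ^ 2 * Δ k ≤ A ^ 2 * α k ^ 2 := by
    intro k
    induction k with
    | zero => exact Or.inl hα0
    | succ k ih =>
      by_cases hk : k ∈ S
      · rw [(hstepS k hk).1]
        refine ih.imp_right fun h => le_trans ?_ h
        have := hanti k
        gcongr
      · obtain ⟨h1, h2, h3⟩ := hstepF k hk
        right
        rw [h1, h2]
        have h4 : ‖gradient f (x k)‖ ^ 2 ≤ (2 * A * α k) ^ 2 := by gcongr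
        have h5 : a * Δ k ≤ A ^ 2 * α k ^ 2 := by linarith [hPL k]
        calc a * θ ^ 2 * Δ k = θ ^ 2 * (a * Δ k) := by ring
          _ ≤ θ ^ 2 * (A ^ 2 * α k ^ 2) := by gcongr
          _ = A ^ 2 * (θ * α k) ^ 2 := by ring
  obtain ⟨V, hV⟩ : ∃ V : ℕ → ℝ, V = fun k => Δ k / c + α k ^ 2 / (1 - θ ^ 2) := ⟨_, rfl⟩
  have hVstep : ∀ k, α k ^ 2 ≤ V k - V (k + 1) := by
    intro k
    simp only [hV]
    by_cases hk : k ∈ S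
    · obtain ⟨h1, h2⟩ := hstepS k hk
      have h3 : α k ^ 2 ≤ (Δ k - Δ (k + 1)) / c := by rw [le_div_iff₀ hc]; linarith
      rw [h1]
      rw [sub_div] at h3
      linarith
    · obtain ⟨h1, h2, -⟩ := hstepF k hk
      rw [h1, h2]
      apply le_of_eq
      field_simp
      ring
  obtain ⟨P, hP⟩ : ∃ P, P = f (x 0) - f xstar + (β / a) * ‖gradient f (x 0)‖ * α₀ + β * α₀ ^ 2 :=
    ⟨_, rfl⟩
  have hP0 : 0 ≤ P := by
    have := hΔ0 0
    rw [hΔk] at this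
    rw [hP]; positivity
  obtain ⟨Q, hQ⟩ : ∃ Q, Q = (1 + η / a) * η + β := ⟨_, rfl⟩
  have hQ0 : 0 ≤ Q := by rw [hQ]; positivity
  have hlate : ∀ k, ‖gradient f (x k)‖ ≤ η * α k →
      Δ k + ‖gradient f (x k)‖ * α k + β * α k ^ 2 ≤ Q * α k ^ 2 := by
    intro k hk
    have h1 : ‖gradient f (x k)‖ ^ 2 ≤ (η * α k) ^ 2 := by gcongr
    have h2 : Δ k ≤ η / a * η * α k ^ 2 := by
      have : 4 * a * Δ k ≤ a * (η / a * η * α k ^ 2) := by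
        calc 4 * a * Δ k ≤ (η * α k) ^ 2 := (hPL k).trans h1
          _ = _ := by field_simp
      have h0 := mul_nonneg ha.le (hΔ0 k)
      exact le_of_mul_le_mul_left (by linarith) ha
    have h3 : ‖gradient f (x k)‖ * α k ≤ η * α k * α k :=
      mul_le_mul_of_nonneg_right hk (hpos k).le
    rw [hQ]
    linarith
  have hround : ∀ k, Δ k + ‖gradient f (x k)‖ * α k + β * α k ^ 2 ≤
      P / (c * α₀ ^ 2) * (Δ k - Δ (k + 1)) + Q * (V k - V (k + 1)) := by
    intro k
    have hQV : Q * α k ^ 2 ≤ Q * (V k - V (k + 1)) := mul_le_mul_of_nonneg_left (hVstep k) hQ0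
    have hPΔ : 0 ≤ P / (c * α₀ ^ 2) * (Δ k - Δ (k + 1)) :=
      mul_nonneg (by positivity) (sub_nonneg.2 (hanti k))
    by_cases hk : k ∈ S
    · rcases hinv k with h | h
      · have h1 : ‖gradient f (x k)‖ ≤ β / a * ‖gradient f (x 0)‖ := by
          refine (sq_le_sq₀ (norm_nonneg _) (by positivity)).1 ?_
          have h2 : a * ‖gradient f (x k)‖ ^ 2 ≤ β ^ 2 * Δ 0 :=
            (hgrad k).trans (mul_le_mul_of_nonneg_left (hanti0 k) (by positivity))
          have h3 : β ^ 2 * (4 * a * Δ 0) ≤ β ^ 2 * ‖gradient f (x 0)‖ ^ 2 :=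
            mul_le_mul_of_nonneg_left (hPL 0) (by positivity)
          rw [mul_pow, div_pow, div_mul_eq_mul_div, le_div_iff₀ (by positivity)]
          nlinarith [mul_nonneg (sq_nonneg a) (sq_nonneg ‖gradient f (x k)‖)]
        have h2 : Δ k + ‖gradient f (x k)‖ * α k + β * α k ^ 2 ≤ P := by
          rw [hP, h, ← hΔk]
          have := hanti0 k
          gcongr
        have h3 : P ≤ P / (c * α₀ ^ 2) * (Δ k - Δ (k + 1)) := by
          calc P = P / (c * α₀ ^ 2) * (c * α₀ ^ 2) := by field_simp
            _ ≤ _ := by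
              gcongr
              rw [← h]
              exact (hstepS k hk).2
        have h4 : 0 ≤ Q * α k ^ 2 := by positivity
        linarith
      · have h1 : ‖gradient f (x k)‖ ≤ η * α k := by
          refine (sq_le_sq₀ (norm_nonneg _) (by have := hpos k; positivity)).1 ?_
          refine le_of_mul_le_mul_left ?_ (by positivity : 0 < a ^ 2 * θ ^ 2)
          calc a ^ 2 * θ ^ 2 * ‖gradient f (x k)‖ ^ 2
              = a * θ ^ 2 * (a * ‖gradient f (x k)‖ ^ 2) := by ring
            _ ≤ a * θ ^ 2 * (β ^ 2 * Δ k) := mul_le_mul_of_nonneg_left (hgrad k) (by positivity)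
            _ = β ^ 2 * (a * θ ^ 2 * Δ k) := by ring
            _ ≤ β ^ 2 * (A ^ 2 * α k ^ 2) := by gcongr
            _ = (β * A) ^ 2 * α k ^ 2 := by ring
            _ = a ^ 2 * θ ^ 2 * (η * α k) ^ 2 := by rw [← hηA]; ring
        linarith [hlate k h1]
    · have h1 : ‖gradient f (x k)‖ ≤ η * α k :=
        (hstepF k hk).2.2.trans (mul_le_mul_of_nonneg_right hAη (hpos k).le)
      linarith [hlate k h1]
  have hV0 : V 0 ≤ 1 / (c * (1 - θ ^ 2)) * (Δ 0 + c * α₀ ^ 2) := by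
    have h1 : Δ 0 / c ≤ Δ 0 / (c * (1 - θ ^ 2)) := by
      apply div_le_div_of_nonneg_left (hΔ0 0) (by positivity)
      nlinarith [mul_pos hc (pow_pos hθ0 2)]
    have h2 : 1 / (c * (1 - θ ^ 2)) * (Δ 0 + c * α₀ ^ 2)
        = Δ 0 / (c * (1 - θ ^ 2)) + α₀ ^ 2 / (1 - θ ^ 2) := by
      field_simp
    simp only [hV]
    rw [h2, hα0]
    linarith
  have hVK : 0 ≤ V (K + 1) := by
    have := hΔ0 (K + 1)
    simp only [hV]; positivity
  rw [← hη, ← hP, ← hQ, ← hΔk]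
  calc ∑ k ∈ Finset.range (K + 1), ((f (x k) - f xstar) + ∑ v ∈ D, (f (x k + α k • v) - f xstar))
      ≤ ∑ k ∈ Finset.range (K + 1), ((D.card : ℝ) + 1) *
          (P / (c * α₀ ^ 2) * (Δ k - Δ (k + 1)) + Q * (V k - V (k + 1))) := by
        refine Finset.sum_le_sum fun k _ => ?_
        refine (polling_regret_le ha hsmooth hβ hconv hunit (hpos k) _ _).trans ?_
        rw [← hΔk]
        exact mul_le_mul_of_nonneg_left (hround k) (by positivity)
    _ = ((D.card : ℝ) + 1) *
          (P / (c * α₀ ^ 2) * (Δ 0 - Δ (K + 1)) + Q * (V 0 - V (K + 1))) := by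
        rw [← Finset.mul_sum, Finset.sum_add_distrib, ← Finset.mul_sum, ← Finset.mul_sum,
          Finset.sum_range_sub', Finset.sum_range_sub']
    _ ≤ _ := by
        gcongr ((D.card : ℝ) + 1) * ?_
        have h1 : P / (c * α₀ ^ 2) * (Δ 0 - Δ (K + 1)) ≤ P / (c * α₀ ^ 2) * Δ 0 :=
          mul_le_mul_of_nonneg_left (by linarith [hΔ0 (K + 1)]) (by positivity)
        have h2 : Q * (V 0 - V (K + 1)) ≤ Q * (1 / (c * (1 - θ ^ 2)) * (Δ 0 + c * α₀ ^ 2)) :=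
          mul_le_mul_of_nonneg_left (by linarith) hQ0
        have h3 : P / (c * α₀ ^ 2) * Δ 0 = Δ 0 / (c * α₀ ^ 2) * P := by ring
        linarith
end

section
/- Gradient bound at an unsuccessful iteration (Lemma 2). Let x ∈ E and α > 0. If f(x) − f(x + α • v) ≤ c α² for every v ∈ D, then ‖∇f(x)‖ ≤ (1/κ)(β/2 + c) α. -/
open RealInnerProductSpace Finset

/-- The descent lemma: a function whose gradient is `β`-Lipschitz lies below its quadratic upper
model. -/
theorem le_add_inner_gradient_add_sq {F : Type*} [NormedAddCommGroup F] [InnerProductSpace ℝ F]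
    [CompleteSpace F] {f : F → ℝ} {β : ℝ} (hf : Differentiable ℝ f)
    (hsmooth : ∀ x y : F, ‖gradient f x - gradient f y‖ ≤ β * ‖x - y‖) (x w : F) :
    f (x + w) ≤ f x + ⟪gradient f x, w⟫ + β / 2 * ‖w‖ ^ 2 := by
  set φ : ℝ → ℝ := fun t ↦ f (x + t • w) - t * ⟪gradient f x, w⟫ - β / 2 * ‖w‖ ^ 2 * t ^ 2 with hφ
  have hderiv (t : ℝ) : HasDerivAt φ
      (⟪gradient f (x + t • w), w⟫ - ⟪gradient f x, w⟫ - β * ‖w‖ ^ 2 * t) t := by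
    have hline : HasDerivAt (fun t : ℝ ↦ x + t • w) w t := by
      simpa using ((hasDerivAt_id t).smul_const w).const_add x
    have hcomp : HasDerivAt (fun t : ℝ ↦ f (x + t • w)) ⟪gradient f (x + t • w), w⟫ t :=
      ((hf (x + t • w)).hasFDerivAt.comp_hasDerivAt t hline).congr_deriv (by simp)
    have hquad : HasDerivAt (fun t : ℝ ↦ β / 2 * ‖w‖ ^ 2 * t ^ 2) (β * ‖w‖ ^ 2 * t) t :=
      ((hasDerivAt_pow 2 t).const_mul (β / 2 * ‖w‖ ^ 2)).congr_deriv (by norm_num; ring)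
    exact (hcomp.sub (hasDerivAt_mul_const _)).sub hquad
  have hanti : AntitoneOn φ (Set.Ici 0) := by
    refine antitoneOn_of_deriv_nonpos (convex_Ici 0)
      (fun t _ ↦ (hderiv t).continuousAt.continuousWithinAt)
      (fun t _ ↦ (hderiv t).differentiableAt.differentiableWithinAt) fun t ht ↦ ?_
    rw [interior_Ici, Set.mem_Ioi] at ht
    rw [(hderiv t).deriv, ← inner_sub_left, sub_nonpos]
    calc ⟪gradient f (x + t • w) - gradient f x, w⟫
        ≤ ‖gradient f (x + t • w) - gradient f x‖ * ‖w‖ := real_inner_le_norm _ _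
      _ ≤ β * ‖x + t • w - x‖ * ‖w‖ := by gcongr; exact hsmooth _ _
      _ = β * ‖w‖ ^ 2 * t := by
        rw [add_sub_cancel_left, norm_smul, Real.norm_of_nonneg ht.le]
        ring
  have hle : φ 1 ≤ φ 0 := hanti (by simp) (by simp) zero_le_one
  simp only [hφ, one_smul, zero_smul, add_zero] at hle
  linarith

theorem stmt2 {d : ℕ} (hd : 1 ≤ d)
    (f : EuclideanSpace ℝ (Fin d) → ℝ) (a β : ℝ) (ha : 0 < a) (hβ : 0 < β)
    (hdiff : ContDiff ℝ 1 f)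
    (hsmooth : ∀ x y : EuclideanSpace ℝ (Fin d), ‖gradient f x - gradient f y‖ ≤ β * ‖x - y‖)
    (hconv : ∀ x y : EuclideanSpace ℝ (Fin d),
      f y ≥ f x + ⟪gradient f x, y - x⟫ + a * ‖y - x‖ ^ 2)
    (D : Finset (EuclideanSpace ℝ (Fin d))) (hDne : D.Nonempty)
    (hunit : ∀ v ∈ D, ‖v‖ = 1) (κ : ℝ) (hκ : 0 < κ)
    (hcm : ∀ u : EuclideanSpace ℝ (Fin d), u ≠ 0 → ∃ v ∈ D, ⟪u, v⟫ ≥ κ * ‖u‖)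
    (c : ℝ) (hc : 0 < c) (p : EuclideanSpace ℝ (Fin d)) (αp : ℝ) (hαp : 0 < αp)
    (hunsucc : ∀ v ∈ D, f p - f (p + αp • v) ≤ c * αp ^ 2) :
    ‖gradient f p‖ ≤ (1 / κ) * (β / 2 + c) * αp := by
  have hbound : 0 ≤ (β / 2 + c) * αp := by positivity
  rw [mul_assoc, one_div, ← div_eq_inv_mul, le_div_iff₀' hκ]
  by_cases hg : gradient f p = 0
  · simpa [hg] using hbound
  obtain ⟨v, hv, hκv⟩ := hcm (-gradient f p) (neg_ne_zero.mpr hg)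
  have hdesc := le_add_inner_gradient_add_sq (hdiff.differentiable one_ne_zero) hsmooth p (αp • v)
  have hdec := hunsucc v hv
  rw [inner_smul_right, norm_smul, hunit v hv, mul_one, Real.norm_of_nonneg hαp.le] at hdesc
  rw [inner_neg_left, norm_neg] at hκv
  refine hκv.le.trans (le_of_mul_le_mul_left ?_ hαp)
  linarith
end

section
/- Summability of forcing terms (Lemma 3). Under the direct-search dynamics, for every K ∈ ℕ, ∑_{k=0}^{K} c α_k² ≤ (1/(1 − θ²)) · ( f(x_0) − f(x*) + c α₀² ). -/
open RealInnerProductSpace Finset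

/-- If `u k - u (k + 1)` dominates `r * w k` for all `k`, then so do the partial sums. -/
theorem mul_sum_range_le_sub_of_step {u w : ℕ → ℝ} {r : ℝ}
    (h : ∀ k, r * w k ≤ u k - u (k + 1)) (n : ℕ) :
    r * ∑ k ∈ Finset.range n, w k ≤ u 0 - u n := by
  rw [Finset.mul_sum, ← Finset.sum_range_sub' u n]
  exact Finset.sum_le_sum fun k _ => h k

theorem stmt3 {d : ℕ} (hd : 1 ≤ d)
    (f : EuclideanSpace ℝ (Fin d) → ℝ) (a β : ℝ) (ha : 0 < a) (hβ : 0 < β)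
    (hdiff : ContDiff ℝ 1 f)
    (hsmooth : ∀ x y : EuclideanSpace ℝ (Fin d), ‖gradient f x - gradient f y‖ ≤ β * ‖x - y‖)
    (hconv : ∀ x y : EuclideanSpace ℝ (Fin d),
      f y ≥ f x + ⟪gradient f x, y - x⟫ + a * ‖y - x‖ ^ 2)
    (xstar : EuclideanSpace ℝ (Fin d)) (hmin : ∀ y, f xstar ≤ f y)
    (D : Finset (EuclideanSpace ℝ (Fin d))) (hDne : D.Nonempty)
    (hunit : ∀ v ∈ D, ‖v‖ = 1)
    (α₀ θ c : ℝ) (hα₀ : 0 < α₀) (hθ : θ ∈ Set.Ioo (0 : ℝ) 1) (hc : 0 < c)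
    (x : ℕ → EuclideanSpace ℝ (Fin d)) (α : ℕ → ℝ) (S : Set ℕ) (hα0 : α 0 = α₀)
    (hsucc : ∀ k ∈ S, ∃ v ∈ D, f (x k) - f (x k + α k • v) ≥ c * α k ^ 2 ∧
      x (k + 1) = x k + α k • v ∧ α (k + 1) = α k)
    (hfail : ∀ k ∉ S, (∀ v ∈ D, f (x k) - f (x k + α k • v) < c * α k ^ 2) ∧
      x (k + 1) = x k ∧ α (k + 1) = θ * α k)
    (K : ℕ) :
    ∑ k ∈ Finset.range (K + 1), c * α k ^ 2 ≤
      (1 / (1 - θ ^ 2)) * (f (x 0) - f xstar + c * α₀ ^ 2) := by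
  have hθ2 : 0 < 1 - θ ^ 2 := by nlinarith [hθ.1, hθ.2]
  have hstep : ∀ k, (1 - θ ^ 2) * (c * α k ^ 2) ≤
      (f (x k) + c * α k ^ 2) - (f (x (k + 1)) + c * α (k + 1) ^ 2) := by
    intro k
    by_cases hk : k ∈ S
    · obtain ⟨v, -, hdec, hx, hα⟩ := hsucc k hk
      rw [hx, hα]
      have : 0 ≤ θ ^ 2 * (c * α k ^ 2) := by positivity
      linarith
    · obtain ⟨-, hx, hα⟩ := hfail k hk
      rw [hx, hα]
      exact le_of_eq (by ring)
  have hsum := mul_sum_range_le_sub_of_step (u := fun k => f (x k) + c * α k ^ 2)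
    (w := fun k => c * α k ^ 2) hstep (K + 1)
  have hlast : 0 ≤ c * α (K + 1) ^ 2 := by positivity
  rw [one_div_mul_eq_div, le_div_iff₀' hθ2, ← hα0]
  linarith [hmin (x (K + 1))]
end

section
/- Bound on the index of the first unsuccessful iteration (Lemma A.4). Under the direct-search dynamics, if all iterations 0, 1, ..., n − 1 are successful (i.e. {0, ..., n−1} ⊆ S), then n ≤ (f(x_0) − f(x*)) / (c α₀²). -/
open RealInnerProductSpace Finset

theorem stmt4 {d : ℕ} (hd : 1 ≤ d)
    (f : EuclideanSpace ℝ (Fin d) → ℝ) (a β : ℝ) (ha : 0 < a) (hβ : 0 < β)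
    (hdiff : ContDiff ℝ 1 f)
    (hsmooth : ∀ x y : EuclideanSpace ℝ (Fin d), ‖gradient f x - gradient f y‖ ≤ β * ‖x - y‖)
    (hconv : ∀ x y : EuclideanSpace ℝ (Fin d),
      f y ≥ f x + ⟪gradient f x, y - x⟫ + a * ‖y - x‖ ^ 2)
    (xstar : EuclideanSpace ℝ (Fin d)) (hmin : ∀ y, f xstar ≤ f y)
    (D : Finset (EuclideanSpace ℝ (Fin d))) (hDne : D.Nonempty)
    (hunit : ∀ v ∈ D, ‖v‖ = 1)
    (α₀ θ c : ℝ) (hα₀ : 0 < α₀) (hθ : θ ∈ Set.Ioo (0 : ℝ) 1) (hc : 0 < c)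
    (x : ℕ → EuclideanSpace ℝ (Fin d)) (α : ℕ → ℝ) (S : Set ℕ) (hα0 : α 0 = α₀)
    (hsucc : ∀ k ∈ S, ∃ v ∈ D, f (x k) - f (x k + α k • v) ≥ c * α k ^ 2 ∧
      x (k + 1) = x k + α k • v ∧ α (k + 1) = α k)
    (hfail : ∀ k ∉ S, (∀ v ∈ D, f (x k) - f (x k + α k • v) < c * α k ^ 2) ∧
      x (k + 1) = x k ∧ α (k + 1) = θ * α k)
    (n : ℕ) (hall : ∀ k < n, k ∈ S) :
    (n : ℝ) ≤ (f (x 0) - f xstar) / (c * α₀ ^ 2) := by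
  have key : ∀ m ≤ n, α m = α₀ ∧ m * (c * α₀ ^ 2) ≤ f (x 0) - f (x m) := by
    intro m
    induction m with
    | zero => simp [hα0]
    | succ k ih =>
      intro hk
      obtain ⟨hαk, hdecr⟩ := ih (by omega)
      obtain ⟨v, -, hv, hx, hα⟩ := hsucc k (hall k (by omega))
      rw [← hx, hαk] at hv
      refine ⟨hα.trans hαk, ?_⟩
      push_cast
      linarith
  rw [le_div_iff₀ (by positivity)]
  linarith [(key n le_rfl).2, hmin (x n)]
end

section
/- Uniform gradient bound after the first unsuccessful iteration (Equation (8)). Under the direct-search dynamics driven by the positive spanning set D, if k ∈ ℕ is such that some iteration j ≤ k is unsuccessful (j ∉ S), then ‖∇f(x_k)‖ ≤ η α_k, where η := (β/(aκθ))(c + β/2). -/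
open RealInnerProductSpace Finset

section DirectSearch

variable {E : Type*} [NormedAddCommGroup E] [InnerProductSpace ℝ E] [CompleteSpace E]

/-- The gradient vanishes at a global minimizer. -/
theorem gradient_eq_zero_of_forall_le {f : E → ℝ} {z : E} (hmin : ∀ y, f z ≤ f y) :
    gradient f z = 0 := by
  have h : IsLocalMin f z := Filter.Eventually.of_forall hmin
  simp [gradient, h.fderiv_eq_zero]

/-- A convex function with `β`-Lipschitz gradient is bounded above by its quadratic model. -/
theorem le_add_inner_add_of_lipschitz_gradient {f : E → ℝ} {a β : ℝ} (ha : 0 < a)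
    (hsmooth : ∀ x y : E, ‖gradient f x - gradient f y‖ ≤ β * ‖x - y‖)
    (hconv : ∀ x y : E, f y ≥ f x + ⟪gradient f x, y - x⟫ + a * ‖y - x‖ ^ 2) (x w : E) :
    f (x + w) ≤ f x + ⟪gradient f x, w⟫ + β * ‖w‖ ^ 2 := by
  have h1 := hconv (x + w) x
  have h2 := hsmooth (x + w) x
  rw [sub_add_cancel_left, inner_neg_right, norm_neg] at h1
  rw [add_sub_cancel_left] at h2
  have h3 := real_inner_le_norm (gradient f (x + w) - gradient f x) w
  rw [inner_sub_left] at h3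
  have h4 := mul_le_mul_of_nonneg_right h2 (norm_nonneg w)
  have h5 : 0 ≤ a * ‖w‖ ^ 2 := by positivity
  nlinarith

/-- Gradient bound at an unsuccessful iterate. -/
theorem mul_norm_gradient_le_of_unsuccessful {f : E → ℝ} {a β c κ t : ℝ} {D : Finset E}
    (ha : 0 < a) (hβ : 0 < β) (hc : 0 < c) (ht : 0 < t)
    (hsmooth : ∀ x y : E, ‖gradient f x - gradient f y‖ ≤ β * ‖x - y‖)
    (hconv : ∀ x y : E, f y ≥ f x + ⟪gradient f x, y - x⟫ + a * ‖y - x‖ ^ 2)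
    (hunit : ∀ v ∈ D, ‖v‖ = 1)
    (hcm : ∀ u : E, u ≠ 0 → ∃ v ∈ D, ⟪u, v⟫ ≥ κ * ‖u‖) {x : E}
    (hfail : ∀ v ∈ D, f x - f (x + t • v) < c * t ^ 2) :
    κ * ‖gradient f x‖ ≤ (c + β) * t := by
  by_cases hg : gradient f x = 0
  · rw [hg, norm_zero, mul_zero]
    positivity
  obtain ⟨v, hv, hin⟩ := hcm (-gradient f x) (neg_ne_zero.mpr hg)
  rw [inner_neg_left, norm_neg] at hin
  have h1 := hfail v hv
  have h2 := le_add_inner_add_of_lipschitz_gradient ha hsmooth hconv x (t • v)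
  rw [real_inner_smul_right, norm_smul, hunit v hv, mul_one, Real.norm_eq_abs, sq_abs] at h2
  have h3 := mul_le_mul_of_nonneg_left hin ht.le
  refine le_of_mul_le_mul_left ?_ ht
  nlinarith

/-- On a sublevel set of a strongly convex smooth function, the gradient is controlled by the
gradient at the point defining the level. -/
theorem mul_norm_gradient_le_of_le {f : E → ℝ} {a β : ℝ} (ha : 0 < a) (hβ : 0 < β)
    (hsmooth : ∀ x y : E, ‖gradient f x - gradient f y‖ ≤ β * ‖x - y‖)
    (hconv : ∀ x y : E, f y ≥ f x + ⟪gradient f x, y - x⟫ + a * ‖y - x‖ ^ 2)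
    {z : E} (hmin : ∀ y, f z ≤ f y) {x y : E} (hle : f y ≤ f x) :
    2 * a * ‖gradient f y‖ ≤ β * ‖gradient f x‖ := by
  have hz := gradient_eq_zero_of_forall_le hmin
  have h1 := hsmooth y z
  have h2 := hconv z y
  have h3 := hconv x z
  rw [hz, sub_zero] at h1
  rw [hz, inner_zero_left] at h2
  have h4 := neg_le_of_abs_le (abs_real_inner_le_norm (gradient f x) (z - x))
  have h5 : 2 * a * ‖y - z‖ ≤ ‖gradient f x‖ := by
    refine le_of_sq_le_sq ?_ (norm_nonneg _)
    nlinarith [sq_nonneg (‖gradient f x‖ - 2 * a * ‖z - x‖)]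
  nlinarith

end DirectSearch

theorem stmt5 {d : ℕ} (hd : 1 ≤ d)
    (f : EuclideanSpace ℝ (Fin d) → ℝ) (a β : ℝ) (ha : 0 < a) (hβ : 0 < β)
    (hdiff : ContDiff ℝ 1 f)
    (hsmooth : ∀ x y : EuclideanSpace ℝ (Fin d), ‖gradient f x - gradient f y‖ ≤ β * ‖x - y‖)
    (hconv : ∀ x y : EuclideanSpace ℝ (Fin d),
      f y ≥ f x + ⟪gradient f x, y - x⟫ + a * ‖y - x‖ ^ 2)
    (xstar : EuclideanSpace ℝ (Fin d)) (hmin : ∀ y, f xstar ≤ f y)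
    (D : Finset (EuclideanSpace ℝ (Fin d))) (hDne : D.Nonempty)
    (hunit : ∀ v ∈ D, ‖v‖ = 1) (κ : ℝ) (hκ : 0 < κ)
    (hcm : ∀ u : EuclideanSpace ℝ (Fin d), u ≠ 0 → ∃ v ∈ D, ⟪u, v⟫ ≥ κ * ‖u‖)
    (α₀ θ c : ℝ) (hα₀ : 0 < α₀) (hθ : θ ∈ Set.Ioo (0 : ℝ) 1) (hc : 0 < c)
    (x : ℕ → EuclideanSpace ℝ (Fin d)) (α : ℕ → ℝ) (S : Set ℕ) (hα0 : α 0 = α₀)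
    (hsucc : ∀ k ∈ S, ∃ v ∈ D, f (x k) - f (x k + α k • v) ≥ c * α k ^ 2 ∧
      x (k + 1) = x k + α k • v ∧ α (k + 1) = α k)
    (hfail : ∀ k ∉ S, (∀ v ∈ D, f (x k) - f (x k + α k • v) < c * α k ^ 2) ∧
      x (k + 1) = x k ∧ α (k + 1) = θ * α k)
    (k : ℕ) (hunsucc : ∃ j ≤ k, j ∉ S) :
    ‖gradient f (x k)‖ ≤ ((β / (a * κ * θ)) * (c + β / 2)) * α k := by
  have hθ0 := hθ.1
  have hα : ∀ n, 0 < α n := by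
    intro n
    induction n with
    | zero => rwa [hα0]
    | succ n ih =>
      by_cases hn : n ∈ S
      · obtain ⟨v, -, -, -, h⟩ := hsucc n hn
        rwa [h]
      · rw [(hfail n hn).2.2]
        exact mul_pos hθ0 ih
  have hlast : ∀ n, (∃ j ≤ n, j ∉ S) → ∃ j ∉ S, θ * α j ≤ α n ∧ f (x n) ≤ f (x j) := by
    intro n
    induction n with
    | zero =>
      rintro ⟨j, hj, hjS⟩
      obtain rfl : j = 0 := by omega
      exact ⟨0, hjS, by nlinarith [hα 0, hθ.2], le_rfl⟩
    | succ n ih =>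
      rintro ⟨j, hj, hjS⟩
      by_cases hn : n ∈ S
      · by_cases hn' : n + 1 ∈ S
        · have hjn : j ≤ n := by
            have : j ≠ n + 1 := fun h => hjS (h ▸ hn')
            omega
          obtain ⟨i, hi, h1, h2⟩ := ih ⟨j, hjn, hjS⟩
          obtain ⟨v, -, hdec, hx, hstep⟩ := hsucc n hn
          refine ⟨i, hi, hstep ▸ h1, ?_⟩
          rw [hx]
          nlinarith [mul_pos hc (pow_pos (hα n) 2)]
        · exact ⟨n + 1, hn', by nlinarith [hα (n + 1), hθ.2], le_rfl⟩
      · obtain ⟨-, hx, hstep⟩ := hfail n hn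
        exact ⟨n, hn, hstep.ge, by rw [hx]⟩
  obtain ⟨j, hj, hstep, hle⟩ := hlast k hunsucc
  have h1 := mul_norm_gradient_le_of_unsuccessful ha hβ hc (hα j) hsmooth hconv hunit hcm
    (hfail j hj).1
  have h2 := mul_norm_gradient_le_of_le ha hβ hsmooth hconv hmin hle
  have key : ‖gradient f (x k)‖ * (a * κ * θ) ≤ β * (c + β / 2) * α k := by
    have h3 : 2 * a * ‖gradient f (x k)‖ * (κ * θ) ≤ β * ‖gradient f (x j)‖ * (κ * θ) :=
      mul_le_mul_of_nonneg_right h2 (by positivity)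
    have h4 : (κ * ‖gradient f (x j)‖) * (β * θ) ≤ ((c + β) * α j) * (β * θ) :=
      mul_le_mul_of_nonneg_right h1 (by positivity)
    have h5 : (θ * α j) * (β * (c + β)) ≤ α k * (β * (c + β)) :=
      mul_le_mul_of_nonneg_right hstep (by positivity)
    have h6 : 0 < β * c * α k := mul_pos (mul_pos hβ hc) (hα k)
    linarith
  calc ‖gradient f (x k)‖ ≤ β * (c + β / 2) * α k / (a * κ * θ) :=
        (le_div_iff₀ (by positivity)).mpr key
    _ = ((β / (a * κ * θ)) * (c + β / 2)) * α k := by ring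
end

section
/- Iterate suboptimality after the first unsuccessful iteration (Lemma A.7). Under the direct-search dynamics driven by the positive spanning set D, let k_f be the index of the first unsuccessful iteration. Then for every K ≥ k_f, ∑_{k=k_f}^{K} ( f(x_k) − f(x*) ) ≤ (η² / (a c)) · (1/(1 − θ²)) · ( f(x_0) − f(x*) + c α₀² ), where η := (β/(aκθ))(c + β/2). -/
open RealInnerProductSpace Finset

theorem le_add_inner_gradient_add_of_lipschitz_gradient {E : Type*} [NormedAddCommGroup E]
    [InnerProductSpace ℝ E] [CompleteSpace E] {f : E → ℝ} {β : ℝ} (hf : Differentiable ℝ f)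
    (hsmooth : ∀ x y : E, ‖gradient f x - gradient f y‖ ≤ β * ‖x - y‖) (x w : E) :
    f (x + w) ≤ f x + ⟪gradient f x, w⟫ + β / 2 * ‖w‖ ^ 2 := by
  have hderiv : ∀ t : ℝ, HasDerivAt
      (fun t : ℝ ↦ f (x + t • w) - t * ⟪gradient f x, w⟫ - β / 2 * ‖w‖ ^ 2 * t ^ 2)
      (⟪gradient f (x + t • w), w⟫ - ⟪gradient f x, w⟫ - β * ‖w‖ ^ 2 * t) t := by
    intro t
    have hline : HasDerivAt (fun t : ℝ ↦ x + t • w) w t := by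
      simpa using ((hasDerivAt_id t).smul_const w).const_add x
    have hcomp := (hf (x + t • w)).hasGradientAt.hasFDerivAt.comp_hasDerivAt t hline
    rw [InnerProductSpace.toDual_apply_apply] at hcomp
    have hlin : HasDerivAt (fun t : ℝ ↦ t * ⟪gradient f x, w⟫) ⟪gradient f x, w⟫ t := by
      simpa using (hasDerivAt_id t).mul_const ⟪gradient f x, w⟫
    have hsq := (hasDerivAt_pow 2 t).const_mul (β / 2 * ‖w‖ ^ 2)
    refine ((hcomp.sub hlin).sub hsq).congr_deriv ?_
    push_cast
    ring
  have hanti := antitoneOn_of_deriv_nonpos (convex_Icc (0 : ℝ) 1)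
    (fun t _ ↦ (hderiv t).continuousAt.continuousWithinAt)
    (fun t _ ↦ (hderiv t).differentiableAt.differentiableWithinAt) (by
      intro t ht
      rw [interior_Icc] at ht
      rw [(hderiv t).deriv, ← inner_sub_left]
      have hcs := real_inner_le_norm (gradient f (x + t • w) - gradient f x) w
      have hlip := hsmooth (x + t • w) x
      rw [add_sub_cancel_left, norm_smul, Real.norm_of_nonneg ht.1.le] at hlip
      nlinarith [mul_le_mul_of_nonneg_right hlip (norm_nonneg w)])
  have h01 := hanti (Set.left_mem_Icc.2 zero_le_one) (Set.right_mem_Icc.2 zero_le_one) zero_le_one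
  simp only [one_smul, zero_smul, add_zero] at h01
  linarith

theorem sub_le_sq_norm_gradient_div_of_strongly_convex {E : Type*} [NormedAddCommGroup E]
    [InnerProductSpace ℝ E] [CompleteSpace E] {f : E → ℝ} {a : ℝ} (ha : 0 < a)
    (hconv : ∀ x y : E, f y ≥ f x + ⟪gradient f x, y - x⟫ + a * ‖y - x‖ ^ 2) (x y : E) :
    f x - f y ≤ ‖gradient f x‖ ^ 2 / (4 * a) := by
  have hcs := neg_le_of_abs_le (abs_real_inner_le_norm (gradient f x) (y - x))
  rw [le_div_iff₀ (by positivity)]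
  nlinarith [hconv x y, sq_nonneg (‖gradient f x‖ - 2 * a * ‖y - x‖)]

theorem two_mul_le_of_strongly_convex_of_lipschitz_gradient {E : Type*} [NormedAddCommGroup E]
    [InnerProductSpace ℝ E] [CompleteSpace E] {f : E → ℝ} {a β : ℝ}
    (hsmooth : ∀ x y : E, ‖gradient f x - gradient f y‖ ≤ β * ‖x - y‖)
    (hconv : ∀ x y : E, f y ≥ f x + ⟪gradient f x, y - x⟫ + a * ‖y - x‖ ^ 2)
    {v : E} (hv : ‖v‖ = 1) : 2 * a ≤ β := by
  have h₁ := hconv 0 v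
  have h₂ := hconv v 0
  have hlip := hsmooth v 0
  have hcs := real_inner_le_norm (gradient f v - gradient f 0) v
  simp only [sub_zero, zero_sub, norm_neg, inner_neg_right, hv, inner_sub_left] at h₁ h₂ hlip hcs
  linarith

/-- At an unsuccessful iterate, the step size controls the gradient. -/
theorem norm_gradient_le_of_forall_sub_lt {E : Type*} [NormedAddCommGroup E]
    [InnerProductSpace ℝ E] [CompleteSpace E] {f : E → ℝ} {β κ c s : ℝ} {D : Finset E}
    (hβ : 0 < β) (hc : 0 < c) (hs : 0 < s) (hf : Differentiable ℝ f)
    (hsmooth : ∀ x y : E, ‖gradient f x - gradient f y‖ ≤ β * ‖x - y‖)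
    (hunit : ∀ v ∈ D, ‖v‖ = 1)
    (hcm : ∀ u : E, u ≠ 0 → ∃ v ∈ D, ⟪u, v⟫ ≥ κ * ‖u‖) {x : E}
    (hfail : ∀ v ∈ D, f x - f (x + s • v) < c * s ^ 2) :
    κ * ‖gradient f x‖ ≤ (c + β / 2) * s := by
  by_cases hg : gradient f x = 0
  · rw [hg, norm_zero, mul_zero]
    positivity
  obtain ⟨v, hvD, hv⟩ := hcm (-gradient f x) (neg_ne_zero.2 hg)
  have hdesc := le_add_inner_gradient_add_of_lipschitz_gradient hf hsmooth x (s • v)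
  rw [inner_smul_right, norm_smul, Real.norm_of_nonneg hs.le, hunit v hvD, mul_one] at hdesc
  rw [inner_neg_left, norm_neg] at hv
  refine le_of_mul_le_mul_left ?_ hs
  nlinarith [hfail v hvD, mul_le_mul_of_nonneg_left hv hs.le]

theorem stmt8 {d : ℕ} (hd : 1 ≤ d)
    (f : EuclideanSpace ℝ (Fin d) → ℝ) (a β : ℝ) (ha : 0 < a) (hβ : 0 < β)
    (hdiff : ContDiff ℝ 1 f)
    (hsmooth : ∀ x y : EuclideanSpace ℝ (Fin d), ‖gradient f x - gradient f y‖ ≤ β * ‖x - y‖)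
    (hconv : ∀ x y : EuclideanSpace ℝ (Fin d),
      f y ≥ f x + ⟪gradient f x, y - x⟫ + a * ‖y - x‖ ^ 2)
    (xstar : EuclideanSpace ℝ (Fin d)) (hmin : ∀ y, f xstar ≤ f y)
    (D : Finset (EuclideanSpace ℝ (Fin d))) (hDne : D.Nonempty)
    (hunit : ∀ v ∈ D, ‖v‖ = 1) (κ : ℝ) (hκ : 0 < κ)
    (hcm : ∀ u : EuclideanSpace ℝ (Fin d), u ≠ 0 → ∃ v ∈ D, ⟪u, v⟫ ≥ κ * ‖u‖)
    (α₀ θ c : ℝ) (hα₀ : 0 < α₀) (hθ : θ ∈ Set.Ioo (0 : ℝ) 1) (hc : 0 < c)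
    (x : ℕ → EuclideanSpace ℝ (Fin d)) (α : ℕ → ℝ) (S : Set ℕ) (hα0 : α 0 = α₀)
    (hsucc : ∀ k ∈ S, ∃ v ∈ D, f (x k) - f (x k + α k • v) ≥ c * α k ^ 2 ∧
      x (k + 1) = x k + α k • v ∧ α (k + 1) = α k)
    (hfail : ∀ k ∉ S, (∀ v ∈ D, f (x k) - f (x k + α k • v) < c * α k ^ 2) ∧
      x (k + 1) = x k ∧ α (k + 1) = θ * α k)
    (hne : {n : ℕ | n ∉ S}.Nonempty) (K : ℕ) (hK : sInf {n : ℕ | n ∉ S} ≤ K) :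
    ∑ k ∈ Finset.Icc (sInf {n : ℕ | n ∉ S}) K, (f (x k) - f xstar) ≤
      (((β / (a * κ * θ)) * (c + β / 2)) ^ 2 / (a * c)) * (1 / (1 - θ ^ 2)) *
        (f (x 0) - f xstar + c * α₀ ^ 2) := by
  obtain ⟨hθ0, hθ1⟩ := hθ
  have hθsq : 0 < 1 - θ ^ 2 := by nlinarith
  have hf : Differentiable ℝ f := hdiff.differentiable one_ne_zero
  have hstep : ∀ k, 0 < α k := by
    intro k
    induction k with
    | zero => rwa [hα0]
    | succ k ih =>
      by_cases hk : k ∈ S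
      · obtain ⟨v, -, -, -, h⟩ := hsucc k hk
        rwa [h]
      · rw [(hfail k hk).2.2]
        positivity
  set η := (β / (a * κ * θ)) * (c + β / 2) with hη
  have hfail_gap : ∀ k ∉ S, f (x k) - f xstar ≤ η ^ 2 / a * (θ * α k) ^ 2 := by
    intro k hk
    have hgrad := norm_gradient_le_of_forall_sub_lt hβ hc (hstep k) hf hsmooth hunit hcm
      (hfail k hk).1
    obtain ⟨v, hv⟩ := hDne
    have haβ := two_mul_le_of_strongly_convex_of_lipschitz_gradient hsmooth hconv (hunit v hv)
    have hηθ : ‖gradient f (x k)‖ ≤ η * (θ * α k) := by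
      have hη_eq : η * (θ * α k) = (β / a) * ((c + β / 2) * α k / κ) := by
        rw [hη]
        field_simp
      rw [hη_eq]
      have hone : 1 ≤ β / a := (one_le_div ha).2 (by linarith)
      have hdiv : ‖gradient f (x k)‖ ≤ (c + β / 2) * α k / κ := by
        rw [le_div_iff₀ hκ]
        linarith
      exact hdiv.trans (le_mul_of_one_le_left ((norm_nonneg _).trans hdiv) hone)
    calc f (x k) - f xstar ≤ ‖gradient f (x k)‖ ^ 2 / (4 * a) :=
          sub_le_sq_norm_gradient_div_of_strongly_convex ha hconv _ _
      _ ≤ (η * (θ * α k)) ^ 2 / a := by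
          gcongr
          linarith
      _ = η ^ 2 / a * (θ * α k) ^ 2 := by ring
  have hM : 0 ≤ η ^ 2 / a := by positivity
  have hgap : ∀ k, sInf {n : ℕ | n ∉ S} ≤ k → f (x k) - f xstar ≤ η ^ 2 / a * α k ^ 2 := by
    intro k hk
    induction k, hk using Nat.le_induction with
    | base =>
      refine (hfail_gap _ (Nat.sInf_mem hne)).trans ?_
      have := hstep (sInf {n : ℕ | n ∉ S})
      gcongr
      exact mul_le_of_le_one_left this.le hθ1.le
    | succ k _ ih =>
      by_cases hk : k ∈ S
      · obtain ⟨v, -, hdec, hx, hα⟩ := hsucc k hk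
        rw [← hx] at hdec
        rw [hα]
        have : 0 ≤ c * α k ^ 2 := by positivity
        linarith
      · rw [(hfail k hk).2.1, (hfail k hk).2.2]
        exact hfail_gap k hk
  have hpotential : ∀ n, ∑ k ∈ range n, α k ^ 2 + (f (x n) - f xstar) / c + α n ^ 2 / (1 - θ ^ 2) ≤
      (f (x 0) - f xstar) / c + α₀ ^ 2 / (1 - θ ^ 2) := by
    intro n
    induction n with
    | zero => simp [hα0]
    | succ n ih =>
      refine le_trans ?_ ih
      rw [sum_range_succ]
      by_cases hn : n ∈ S
      · obtain ⟨v, -, hdec, hx, hα⟩ := hsucc n hn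
        rw [← hx] at hdec
        rw [hα]
        have : α n ^ 2 + (f (x (n + 1)) - f xstar) / c ≤ (f (x n) - f xstar) / c := by
          rw [← sub_nonneg, show (f (x n) - f xstar) / c -
            (α n ^ 2 + (f (x (n + 1)) - f xstar) / c) =
            (f (x n) - f (x (n + 1)) - c * α n ^ 2) / c by field_simp; ring]
          exact div_nonneg (by linarith) hc.le
        linarith
      · rw [(hfail n hn).2.1, (hfail n hn).2.2]
        apply le_of_eq
        field_simp
        ring
  have hsum : ∑ k ∈ range (K + 1), α k ^ 2 ≤
      (f (x 0) - f xstar) / c + α₀ ^ 2 / (1 - θ ^ 2) := by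
    have h₁ : 0 ≤ (f (x (K + 1)) - f xstar) / c := div_nonneg (sub_nonneg.2 (hmin _)) hc.le
    have h₂ : 0 ≤ α (K + 1) ^ 2 / (1 - θ ^ 2) := by positivity
    linarith [hpotential (K + 1)]
  calc ∑ k ∈ Finset.Icc (sInf {n : ℕ | n ∉ S}) K, (f (x k) - f xstar)
      ≤ ∑ k ∈ Finset.Icc (sInf {n : ℕ | n ∉ S}) K, η ^ 2 / a * α k ^ 2 :=
        sum_le_sum fun k hk ↦ hgap k (Finset.mem_Icc.1 hk).1
    _ ≤ ∑ k ∈ range (K + 1), η ^ 2 / a * α k ^ 2 :=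
        sum_le_sum_of_subset_of_nonneg
          (fun k hk ↦ mem_range.2 (Nat.lt_succ_of_le (Finset.mem_Icc.1 hk).2))
          fun k _ _ ↦ by positivity
    _ = η ^ 2 / a * ∑ k ∈ range (K + 1), α k ^ 2 := (mul_sum _ _ _).symm
    _ ≤ η ^ 2 / a * ((f (x 0) - f xstar) / c / (1 - θ ^ 2) + α₀ ^ 2 / (1 - θ ^ 2)) := by
        gcongr
        refine hsum.trans (add_le_add_left (le_div_self ?_ hθsq (by nlinarith)) _)
        exact div_nonneg (sub_nonneg.2 (hmin _)) hc.le
    _ = η ^ 2 / (a * c) * (1 / (1 - θ ^ 2)) * (f (x 0) - f xstar + c * α₀ ^ 2) := by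
        field_simp
end

section
/- Summability of forcing terms in the noisy case (Lemma B.6). Under the noisy direct-search dynamics, for every K ∈ ℕ, ∑_{k=0}^{K} c α_k² ≤ (2/(1 − θ²)) · ( f(x_0) − f(x*) + c α₀² ). -/
open RealInnerProductSpace Finset

/-- Telescoping: a nonnegative potential that drops by at least `u k` at each step bounds every
partial sum of `u`. -/
theorem sum_range_le_of_le_sub_succ {u p : ℕ → ℝ} (hp : ∀ k, 0 ≤ p k)
    (hu : ∀ k, u k ≤ p k - p (k + 1)) (n : ℕ) : ∑ k ∈ Finset.range n, u k ≤ p 0 := by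
  calc ∑ k ∈ Finset.range n, u k ≤ ∑ k ∈ Finset.range n, (p k - p (k + 1)) :=
        Finset.sum_le_sum fun k _ => hu k
    _ = p 0 - p n := Finset.sum_range_sub' p n
    _ ≤ p 0 := sub_le_self _ (hp n)

theorem stmt11 {d : ℕ} (hd : 1 ≤ d)
    (f : EuclideanSpace ℝ (Fin d) → ℝ) (a β : ℝ) (ha : 0 < a) (hβ : 0 < β)
    (hdiff : ContDiff ℝ 1 f)
    (hsmooth : ∀ x y : EuclideanSpace ℝ (Fin d), ‖gradient f x - gradient f y‖ ≤ β * ‖x - y‖)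
    (hconv : ∀ x y : EuclideanSpace ℝ (Fin d),
      f y ≥ f x + ⟪gradient f x, y - x⟫ + a * ‖y - x‖ ^ 2)
    (xstar : EuclideanSpace ℝ (Fin d)) (hmin : ∀ y, f xstar ≤ f y)
    (D : Finset (EuclideanSpace ℝ (Fin d))) (hDne : D.Nonempty)
    (hunit : ∀ v ∈ D, ‖v‖ = 1)
    (α₀ θ c : ℝ) (hα₀ : 0 < α₀) (hθ : θ ∈ Set.Ioo (0 : ℝ) 1) (hc : 0 < c)
    (x : ℕ → EuclideanSpace ℝ (Fin d)) (α : ℕ → ℝ) (S : Set ℕ) (hα0 : α 0 = α₀)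
    (hsucc : ∀ k ∈ S, ∃ v ∈ D, f (x k) - f (x k + α k • v) ≥ (c / 2) * α k ^ 2 ∧
      x (k + 1) = x k + α k • v ∧ α (k + 1) = α k)
    (hfail : ∀ k ∉ S, (∀ v ∈ D, f (x k) - f (x k + α k • v) ≤ (3 * c / 2) * α k ^ 2) ∧
      x (k + 1) = x k ∧ α (k + 1) = θ * α k)
    (K : ℕ) :
    ∑ k ∈ Finset.range (K + 1), c * α k ^ 2 ≤
      (2 / (1 - θ ^ 2)) * (f (x 0) - f xstar + c * α₀ ^ 2) := by
  obtain ⟨hθ0, hθ1⟩ := hθ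
  have hθsq : 0 < 1 - θ ^ 2 := by nlinarith
  have hdecrease : ∀ k, (1 - θ ^ 2) / 2 * (c * α k ^ 2) ≤
      (f (x k) - f xstar + c * α k ^ 2) - (f (x (k + 1)) - f xstar + c * α (k + 1) ^ 2) := by
    intro k
    have hck : 0 ≤ c * α k ^ 2 := by positivity
    by_cases hk : k ∈ S
    · obtain ⟨v, -, hv, hx, hα⟩ := hsucc k hk
      rw [hx, hα]
      nlinarith [mul_nonneg (sq_nonneg θ) hck]
    · obtain ⟨-, hx, hα⟩ := hfail k hk
      rw [hx, hα]
      nlinarith [mul_nonneg hθsq.le hck]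
  have hsum := sum_range_le_of_le_sub_succ
    (p := fun k => f (x k) - f xstar + c * α k ^ 2)
    (fun k => add_nonneg (sub_nonneg.2 (hmin (x k))) (by positivity)) hdecrease (K + 1)
  rw [← Finset.mul_sum, hα0] at hsum
  rw [div_mul_eq_mul_div, le_div_iff₀ hθsq]
  linarith
end

section
/- Bound on the index of the first unsuccessful iteration in the noisy case (Lemma B.7). Under the noisy direct-search dynamics, if all iterations 0, 1, ..., n − 1 are successful (i.e. {0, ..., n−1} ⊆ S), then n ≤ 2 (f(x_0) − f(x*)) / (c α₀²). -/
open RealInnerProductSpace Finset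

theorem stmt12 {d : ℕ} (hd : 1 ≤ d)
    (f : EuclideanSpace ℝ (Fin d) → ℝ) (a β : ℝ) (ha : 0 < a) (hβ : 0 < β)
    (hdiff : ContDiff ℝ 1 f)
    (hsmooth : ∀ x y : EuclideanSpace ℝ (Fin d), ‖gradient f x - gradient f y‖ ≤ β * ‖x - y‖)
    (hconv : ∀ x y : EuclideanSpace ℝ (Fin d),
      f y ≥ f x + ⟪gradient f x, y - x⟫ + a * ‖y - x‖ ^ 2)
    (xstar : EuclideanSpace ℝ (Fin d)) (hmin : ∀ y, f xstar ≤ f y)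
    (D : Finset (EuclideanSpace ℝ (Fin d))) (hDne : D.Nonempty)
    (hunit : ∀ v ∈ D, ‖v‖ = 1)
    (α₀ θ c : ℝ) (hα₀ : 0 < α₀) (hθ : θ ∈ Set.Ioo (0 : ℝ) 1) (hc : 0 < c)
    (x : ℕ → EuclideanSpace ℝ (Fin d)) (α : ℕ → ℝ) (S : Set ℕ) (hα0 : α 0 = α₀)
    (hsucc : ∀ k ∈ S, ∃ v ∈ D, f (x k) - f (x k + α k • v) ≥ (c / 2) * α k ^ 2 ∧
      x (k + 1) = x k + α k • v ∧ α (k + 1) = α k)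
    (hfail : ∀ k ∉ S, (∀ v ∈ D, f (x k) - f (x k + α k • v) ≤ (3 * c / 2) * α k ^ 2) ∧
      x (k + 1) = x k ∧ α (k + 1) = θ * α k)
    (n : ℕ) (hall : ∀ k < n, k ∈ S) :
    (n : ℝ) ≤ 2 * (f (x 0) - f xstar) / (c * α₀ ^ 2) := by
  have descent : ∀ m ≤ n, α m = α₀ ∧ f (x m) ≤ f (x 0) - m * (c / 2 * α₀ ^ 2) := by
    intro m
    induction m with
    | zero => simp [hα0]
    | succ k ih =>
      intro hk
      obtain ⟨hαk, hfk⟩ := ih (by omega)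
      obtain ⟨v, -, hdec, hx, hα⟩ := hsucc k (hall k (by omega))
      rw [← hx, hαk] at hdec
      refine ⟨hα.trans hαk, ?_⟩
      push_cast
      linarith
  have hbound := (descent n le_rfl).2
  rw [le_div_iff₀ (by positivity)]
  linarith [hmin (x n)]
end

section
/- Lower bound on the projected-gradient criticality measure (Lemma C.3). Let 𝒟 ⊆ E be a convex set, let x* ∈ 𝒟 be the minimizer of f over 𝒟, and let x ∈ 𝒟 with x ≠ x*. Assume that the unit step towards the minimizer is feasible, i.e. x + (x* − x)/‖x* − x‖ ∈ 𝒟 (this holds by convexity whenever ‖x − x*‖ ≥ 1). Then a ‖x − x*‖ ≤ χ(x). -/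
open RealInnerProductSpace Finset

noncomputable def chi {d : ℕ} (f : EuclideanSpace ℝ (Fin d) → ℝ)
    (Dom : Set (EuclideanSpace ℝ (Fin d))) (p : EuclideanSpace ℝ (Fin d)) : ℝ :=
  sSup {r : ℝ | ∃ v : EuclideanSpace ℝ (Fin d),
    ‖v‖ ≤ 1 ∧ p + v ∈ Dom ∧ r = ⟪-gradient f p, v⟫}

theorem stmt15 {d : ℕ} (hd : 1 ≤ d)
    (f : EuclideanSpace ℝ (Fin d) → ℝ) (a β : ℝ) (ha : 0 < a) (hβ : 0 < β)
    (hdiff : ContDiff ℝ 1 f)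
    (hsmooth : ∀ x y : EuclideanSpace ℝ (Fin d), ‖gradient f x - gradient f y‖ ≤ β * ‖x - y‖)
    (hconv : ∀ x y : EuclideanSpace ℝ (Fin d),
      f y ≥ f x + ⟪gradient f x, y - x⟫ + a * ‖y - x‖ ^ 2)
    (Dom : Set (EuclideanSpace ℝ (Fin d))) (hDom : Convex ℝ Dom)
    (xstar : EuclideanSpace ℝ (Fin d)) (hxstar : xstar ∈ Dom)
    (hmin : ∀ y ∈ Dom, f xstar ≤ f y)
    (p : EuclideanSpace ℝ (Fin d)) (hp : p ∈ Dom) (hne : p ≠ xstar)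
    (hfeas : p + ‖xstar - p‖⁻¹ • (xstar - p) ∈ Dom) :
    a * ‖p - xstar‖ ≤ chi f Dom p := by
  have hr : 0 < ‖xstar - p‖ := norm_pos_iff.2 (sub_ne_zero.2 hne.symm)
  have hbdd : BddAbove {r : ℝ | ∃ v : EuclideanSpace ℝ (Fin d),
      ‖v‖ ≤ 1 ∧ p + v ∈ Dom ∧ r = ⟪-gradient f p, v⟫} := by
    refine ⟨‖-gradient f p‖, ?_⟩
    rintro _ ⟨v, hv, -, rfl⟩
    exact (real_inner_le_norm _ _).trans (mul_le_of_le_one_right (norm_nonneg _) hv)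
  have hunit : ‖‖xstar - p‖⁻¹ • (xstar - p)‖ ≤ 1 := by
    rw [norm_smul, norm_inv, norm_norm, inv_mul_cancel₀ hr.ne']
  have hdescent : a * ‖xstar - p‖ ^ 2 ≤ ⟪-gradient f p, xstar - p⟫ := by
    rw [inner_neg_left]
    linarith [hconv p xstar, hmin p hp]
  refine le_trans ?_ (le_csSup hbdd ⟨_, hunit, hfeas, rfl⟩)
  rw [inner_smul_right, norm_sub_rev, inv_mul_eq_div, le_div_iff₀ hr]
  linarith
end

section
/- Growth bound on the criticality measure along a descent when the optimum is interior (Lemma C.4). Let 𝒟 ⊆ E be a convex set and let x* ∈ 𝒟 be the minimizer of f over 𝒟 with ∇f(x*) = 0 (x* lies in the interior of 𝒟). Let x, x' ∈ 𝒟 with f(x') ≤ f(x), x ≠ x*, and assume x + (x* − x)/‖x* − x‖ ∈ 𝒟 (so that a‖x − x*‖ ≤ χ(x)). Then χ(x') ≤ (β/a)^{3/2} χ(x). -/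
open RealInnerProductSpace Finset

theorem inner_neg_gradient_le {d : ℕ} (f : EuclideanSpace ℝ (Fin d) → ℝ)
    (p : EuclideanSpace ℝ (Fin d)) {v : EuclideanSpace ℝ (Fin d)} (hv : ‖v‖ ≤ 1) :
    ⟪-gradient f p, v⟫ ≤ ‖gradient f p‖ :=
  calc ⟪-gradient f p, v⟫ ≤ ‖-gradient f p‖ * ‖v‖ := real_inner_le_norm _ _
    _ ≤ ‖gradient f p‖ := by
      rw [norm_neg]
      exact mul_le_of_le_one_right (norm_nonneg _) hv

theorem chi_le_norm_gradient {d : ℕ} (f : EuclideanSpace ℝ (Fin d) → ℝ)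
    (Dom : Set (EuclideanSpace ℝ (Fin d))) (p : EuclideanSpace ℝ (Fin d)) :
    chi f Dom p ≤ ‖gradient f p‖ := by
  refine Real.sSup_le ?_ (norm_nonneg _)
  rintro r ⟨v, hv, -, rfl⟩
  exact inner_neg_gradient_le f p hv

theorem inner_neg_gradient_le_chi {d : ℕ} (f : EuclideanSpace ℝ (Fin d) → ℝ)
    {Dom : Set (EuclideanSpace ℝ (Fin d))} {p v : EuclideanSpace ℝ (Fin d)}
    (hv : ‖v‖ ≤ 1) (hpv : p + v ∈ Dom) : ⟪-gradient f p, v⟫ ≤ chi f Dom p := by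
  refine le_csSup ⟨‖gradient f p‖, ?_⟩ ⟨v, hv, hpv, rfl⟩
  rintro r ⟨w, hw, -, rfl⟩
  exact inner_neg_gradient_le f p hw

theorem stmt16 {d : ℕ} (hd : 1 ≤ d)
    (f : EuclideanSpace ℝ (Fin d) → ℝ) (a β : ℝ) (ha : 0 < a) (hβ : 0 < β)
    (hdiff : ContDiff ℝ 1 f)
    (hsmooth : ∀ x y : EuclideanSpace ℝ (Fin d), ‖gradient f x - gradient f y‖ ≤ β * ‖x - y‖)
    (hconv : ∀ x y : EuclideanSpace ℝ (Fin d),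
      f y ≥ f x + ⟪gradient f x, y - x⟫ + a * ‖y - x‖ ^ 2)
    (Dom : Set (EuclideanSpace ℝ (Fin d))) (hDom : Convex ℝ Dom)
    (xstar : EuclideanSpace ℝ (Fin d)) (hxstar : xstar ∈ Dom)
    (hmin : ∀ y ∈ Dom, f xstar ≤ f y) (hgrad : gradient f xstar = 0)
    (p q : EuclideanSpace ℝ (Fin d)) (hp : p ∈ Dom) (hq : q ∈ Dom)
    (hdesc : f q ≤ f p) (hne : p ≠ xstar)
    (hfeas : p + ‖xstar - p‖⁻¹ • (xstar - p) ∈ Dom) :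
    chi f Dom q ≤ (β / a) ^ ((3 : ℝ) / 2) * chi f Dom p := by
  set r := ‖xstar - p‖ with hr
  have hr0 : 0 < r := norm_pos_iff.mpr (sub_ne_zero.mpr hne.symm)
  have hgrowth (y : EuclideanSpace ℝ (Fin d)) : f xstar + a * ‖y - xstar‖ ^ 2 ≤ f y := by
    simpa [hgrad] using hconv xstar y
  have hgrad_le (y : EuclideanSpace ℝ (Fin d)) : ‖gradient f y‖ ≤ β * ‖y - xstar‖ := by
    simpa [hgrad] using hsmooth y xstar
  have hpr : ‖p - xstar‖ = r := norm_sub_rev _ _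
  have hp_growth := hgrowth p
  have hp_grad := hgrad_le p
  have hq_growth := hgrowth q
  have hp_conv := hconv p xstar
  rw [hpr] at hp_growth hp_grad
  rw [← hr] at hp_conv
  have hinner : -⟪gradient f p, xstar - p⟫ ≤ β * r ^ 2 := by
    have h := real_inner_le_norm (-gradient f p) (xstar - p)
    rw [inner_neg_left, norm_neg, ← hr] at h
    nlinarith
  have hchi : a * r ≤ chi f Dom p := by
    refine le_trans ?_ (inner_neg_gradient_le_chi f ?_ hfeas)
    · rw [inner_smul_right, inner_neg_left, le_inv_mul_iff₀ hr0]
      nlinarith [mul_pos ha (pow_pos hr0 2)]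
    · rw [norm_smul, norm_inv, norm_norm, ← hr, inv_mul_cancel₀ hr0.ne']
  have hratio : ‖q - xstar‖ ≤ √(β / a) * r := by
    refine (sq_le_sq₀ (norm_nonneg _) (by positivity)).mp ?_
    rw [mul_pow, Real.sq_sqrt (by positivity), div_mul_eq_mul_div, le_div_iff₀ ha]
    nlinarith [mul_pos ha (pow_pos hr0 2)]
  have hpow : (β / a) ^ ((3 : ℝ) / 2) = β / a * √(β / a) := by
    rw [Real.sqrt_eq_rpow, show (3 : ℝ) / 2 = 1 + 1 / 2 by norm_num,
      Real.rpow_add (by positivity), Real.rpow_one]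
  calc chi f Dom q ≤ β * ‖q - xstar‖ := (chi_le_norm_gradient f Dom q).trans (hgrad_le q)
    _ ≤ β * (√(β / a) * r) := by gcongr
    _ = (β / a) ^ ((3 : ℝ) / 2) * (a * r) := by
      rw [hpow]
      field_simp
    _ ≤ (β / a) ^ ((3 : ℝ) / 2) * chi f Dom p := by gcongr
end
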